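/- arXiv:1501.06645 — 10 statements merged into one kernel-verified Lean document; each statement's English description precedes it below -/
import Mathlib

section
/- Let S and Q be n×n real positive definite matrices. Then S⁻¹ - Q is positive definite if and only if there exists a real n×n matrix R such that RᵀQR + S - (R + Rᵀ) is negative definite. -/
open Matrix

/-- Lemma 2: `Q < S⁻¹` (Loewner) iff there exists `R` with
`RᵀQR + S - (R + Rᵀ) < 0`. -/
theorem lemma2_strict {n : ℕ} (S Q : Matrix (Fin n) (Fin n) ℝ)
    (hS : S.PosDef) (hQ : Q.PosDef) :
    (S⁻¹ - Q).PosDef ↔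
      ∃ R : Matrix (Fin n) (Fin n) ℝ,
        (-(Rᵀ * Q * R + S - (R + Rᵀ))).PosDef := by
  have hSt : Sᵀ = S := hS.isHermitian
  have hQt : Qᵀ = Q := hQ.isHermitian
  have hSdet : IsUnit S.det := (isUnit_iff_isUnit_det S).1 hS.isUnit
  have hQdet : IsUnit Q.det := (isUnit_iff_isUnit_det Q).1 hQ.isUnit
  have hSS := mul_nonsing_inv S hSdet
  have hQQ := mul_nonsing_inv Q hQdet
  have hSS' := nonsing_inv_mul S hSdet
  have hQQ' := nonsing_inv_mul Q hQdet
  constructor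
  · intro h
    refine ⟨S, ?_⟩
    convert h.conjTranspose_mul_mul_same (mulVec_injective_of_isUnit hS.isUnit) using 1
    rw [conjTranspose_eq_transpose_of_trivial, hSt, mul_sub, sub_mul, hSS, one_mul]
    abel
  · rintro ⟨R, hR⟩
    have hQS : (Q⁻¹ - S).PosDef := by
      convert hR.add_posSemidef (hQ.posSemidef.conjTranspose_mul_mul_same (R - Q⁻¹)) using 1
      rw [conjTranspose_eq_transpose_of_trivial, transpose_sub, transpose_nonsing_inv, hQt,
        sub_mul, hQQ', sub_mul, mul_sub, mul_assoc Rᵀ Q Q⁻¹, hQQ, mul_one, one_mul]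
      abel
    convert (hQS.conjTranspose_mul_mul_same (mulVec_injective_of_isUnit hQ.isUnit)).add_posSemidef
      (hS.posSemidef.conjTranspose_mul_mul_same (Q - S⁻¹)) using 1
    rw [conjTranspose_eq_transpose_of_trivial, conjTranspose_eq_transpose_of_trivial,
      transpose_sub, transpose_nonsing_inv, hQt, hSt, mul_sub, sub_mul, hQQ, one_mul,
      sub_mul, hSS', sub_mul, mul_sub, mul_assoc Q S S⁻¹, hSS, mul_one, one_mul]
    abel
end

section
/- Let S and Q be n×n real positive definite matrices. Then S⁻¹ - Q is positive semidefinite if and only if there exists a real n×n matrix R such that (R + Rᵀ) - (RᵀQR + S) is positive semidefinite. -/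
open Matrix

/-- Inversion reverses the Loewner order on positive definite matrices. -/
theorem posSemidef_inv_sub_iff_posSemidef_inv_sub {m : Type*} [Fintype m] [DecidableEq m]
    {S Q : Matrix m m ℝ} (hS : S.PosDef) (hQ : Q.PosDef) :
    (S⁻¹ - Q).PosSemidef ↔ (Q⁻¹ - S).PosSemidef := by
  have hSi : S⁻¹.PosDef := hS.inv
  have hQi : Q⁻¹.PosDef := hQ.inv
  have := hSi.isUnit.invertible
  have := hQi.isUnit.invertible
  have h₁ := hSi.fromBlocks₁₁ 1 Q⁻¹
  have h₂ := PosDef.fromBlocks₂₂ S⁻¹ 1 hQi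
  rw [nonsing_inv_nonsing_inv _ ((isUnit_iff_isUnit_det _).mp hS.isUnit)] at h₁
  rw [nonsing_inv_nonsing_inv _ ((isUnit_iff_isUnit_det _).mp hQ.isUnit)] at h₂
  simp only [conjTranspose_one, Matrix.one_mul, Matrix.mul_one] at h₁ h₂
  exact h₂.symm.trans h₁

/-- Lemma 2 (non-strict version): `Q ≤ S⁻¹` (Loewner) iff there exists `R` with
`RᵀQR + S - (R + Rᵀ) ≤ 0`. -/
theorem lemma2_nonstrict {n : ℕ} (S Q : Matrix (Fin n) (Fin n) ℝ)
    (hS : S.PosDef) (hQ : Q.PosDef) :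
    (S⁻¹ - Q).PosSemidef ↔
      ∃ R : Matrix (Fin n) (Fin n) ℝ,
        ((R + Rᵀ) - (Rᵀ * Q * R + S)).PosSemidef := by
  rw [posSemidef_inv_sub_iff_posSemidef_inv_sub hS hQ]
  have hdet : IsUnit Q.det := (isUnit_iff_isUnit_det _).mp hQ.isUnit
  have hT : Q⁻¹ᵀ = Q⁻¹ := by simpa using hQ.inv.isHermitian.eq
  constructor
  · intro h
    refine ⟨Q⁻¹, ?_⟩
    rwa [hT, nonsing_inv_mul _ hdet, Matrix.one_mul, add_sub_add_left_eq_sub]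
  · rintro ⟨R, hR⟩
    have key : Q⁻¹ - S =
        ((R + Rᵀ) - (Rᵀ * Q * R + S)) + (R - Q⁻¹)ᴴ * Q * (R - Q⁻¹) := by
      rw [conjTranspose_eq_transpose_of_trivial, transpose_sub, hT, Matrix.sub_mul,
        nonsing_inv_mul _ hdet, Matrix.mul_sub, Matrix.sub_mul, Matrix.sub_mul,
        Matrix.mul_assoc Rᵀ Q Q⁻¹, mul_nonsing_inv _ hdet]
      simp only [Matrix.one_mul, Matrix.mul_one]
      abel
    rw [key]
    exact hR.add (hQ.posSemidef.conjTranspose_mul_mul_same _)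
end

section
/- Let Q be an n×n real positive definite matrix, τ > 0 a real number, and ω : [-τ, 0] → ℝⁿ a function such that ω and the scalar function s ↦ ω(s)ᵀQω(s) are integrable on [-τ, 0]. Then (∫_{-τ}^0 ω(s) ds)ᵀ Q (∫_{-τ}^0 ω(s) ds) ≤ τ · ∫_{-τ}^0 ω(s)ᵀ Q ω(s) ds. -/
open Matrix MeasureTheory

/-- Tangent-line bound for a positive semidefinite quadratic form. -/
theorem Matrix.PosSemidef.tangent_le {ι : Type*} [Fintype ι] {Q : Matrix ι ι ℝ}
    (hQ : Q.PosSemidef) (t : ℝ) (v x : ι → ℝ) :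
    2 * t * (v ⬝ᵥ (Q *ᵥ x)) - v ⬝ᵥ (Q *ᵥ v) ≤ t ^ 2 * (x ⬝ᵥ (Q *ᵥ x)) := by
  have hnonneg := hQ.dotProduct_mulVec_nonneg (t • x - v)
  have hsymm : x ⬝ᵥ (Q *ᵥ v) = v ⬝ᵥ (Q *ᵥ x) := by
    have hT : Qᵀ = Q := by simpa [conjTranspose_eq_transpose_of_trivial] using hQ.isHermitian.eq
    rw [← dotProduct_transpose_mulVec, hT]
  simp only [star_trivial, mulVec_sub, mulVec_smul, sub_dotProduct, dotProduct_sub,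
    smul_dotProduct, dotProduct_smul, smul_eq_mul, hsymm] at hnonneg
  linarith

/-- Jensen's inequality for a positive semidefinite quadratic form and a finite measure. -/
theorem Matrix.PosSemidef.integral_dotProduct_mulVec_le {ι α : Type*} [Fintype ι]
    [MeasurableSpace α] {μ : Measure α} [IsFiniteMeasure μ] {Q : Matrix ι ι ℝ}
    (hQ : Q.PosSemidef) {f : α → ι → ℝ} (hf : Integrable f μ)
    (hq : Integrable (fun s => f s ⬝ᵥ (Q *ᵥ f s)) μ) :
    (∫ s, f s ∂μ) ⬝ᵥ (Q *ᵥ ∫ s, f s ∂μ) ≤ μ.real Set.univ * ∫ s, f s ⬝ᵥ (Q *ᵥ f s) ∂μ := by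
  rcases eq_or_ne μ 0 with rfl | hμ
  · simp
  have : NeZero μ := ⟨hμ⟩
  have hpos : 0 < μ.real Set.univ := measureReal_univ_pos
  set t := μ.real Set.univ with ht
  set v := ∫ s, f s ∂μ
  let L : (ι → ℝ) →L[ℝ] ℝ := LinearMap.toContinuousLinearMap
    { toFun := fun x => v ⬝ᵥ (Q *ᵥ x)
      map_add' := fun x y => by rw [mulVec_add, dotProduct_add]
      map_smul' := fun c x => by rw [mulVec_smul, dotProduct_smul, RingHom.id_apply] }
  have hLi : Integrable (fun s => v ⬝ᵥ (Q *ᵥ f s)) μ := L.integrable_comp hf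
  have hL : ∫ s, v ⬝ᵥ (Q *ᵥ f s) ∂μ = v ⬝ᵥ (Q *ᵥ v) := L.integral_comp_comm hf
  have hmono := integral_mono ((hLi.const_mul (2 * t)).sub (integrable_const (v ⬝ᵥ (Q *ᵥ v))))
    (hq.const_mul (t ^ 2)) (fun s => hQ.tangent_le t v (f s))
  simp only [Pi.sub_apply] at hmono
  rw [integral_sub (hLi.const_mul _) (integrable_const _), integral_const_mul,
    integral_const_mul, integral_const, hL, smul_eq_mul, ← ht] at hmono
  refine le_of_mul_le_mul_left ?_ hpos
  linarith

/-- The continuous-time Jensen inequality: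
`(∫_{-τ}^0 ω)ᵀ Q (∫_{-τ}^0 ω) ≤ τ ∫_{-τ}^0 ωᵀQω`. -/
theorem continuous_jensen {n : ℕ}
    (Q : Matrix (Fin n) (Fin n) ℝ) (hQ : Q.PosDef)
    (τ : ℝ) (hτ : 0 < τ) (ω : ℝ → (Fin n → ℝ))
    (hω : IntegrableOn ω (Set.Icc (-τ) 0))
    (hq : IntegrableOn (fun s => ω s ⬝ᵥ (Q *ᵥ ω s)) (Set.Icc (-τ) 0)) :
    (∫ s in Set.Icc (-τ) 0, ω s) ⬝ᵥ (Q *ᵥ ∫ s in Set.Icc (-τ) 0, ω s)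
      ≤ τ * ∫ s in Set.Icc (-τ) 0, ω s ⬝ᵥ (Q *ᵥ ω s) := by
  simpa [hτ.le] using hQ.posSemidef.integral_dotProduct_mulVec_le hω hq
end

section
/- Let N be a positive integer, Q an n×n real positive definite matrix, τ₁, …, τ_N positive real numbers, and for each i ∈ {1, …, N} let ωᵢ : [-τᵢ, 0] → ℝⁿ be a function such that ωᵢ and s ↦ ωᵢ(s)ᵀQωᵢ(s) are integrable on [-τᵢ, 0]. Set xᵢ = ∫_{-τᵢ}^0 ωᵢ(s) ds. Then (∑_{i=1}^N xᵢ)ᵀ Q (∑_{i=1}^N xᵢ) ≤ N · ∑_{i=1}^N τᵢ ∫_{-τᵢ}^0 ωᵢ(s)ᵀ Q ωᵢ(s) ds. -/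
open Matrix MeasureTheory

/-- Cauchy–Schwarz/Jensen inequality for a positive semidefinite quadratic form and a finite
measure. -/
theorem Matrix.PosSemidef.quadratic_integral_le {n α : Type*} [Fintype n] [MeasurableSpace α]
    {Q : Matrix n n ℝ} (hQ : Q.PosSemidef) (μ : Measure α) [IsFiniteMeasure μ]
    {f : α → n → ℝ} (hf : Integrable f μ)
    (hq : Integrable (fun a => f a ⬝ᵥ (Q *ᵥ f a)) μ) :
    (∫ a, f a ∂μ) ⬝ᵥ (Q *ᵥ ∫ a, f a ∂μ) ≤ μ.real Set.univ * ∫ a, f a ⬝ᵥ (Q *ᵥ f a) ∂μ := by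
  rcases eq_or_ne μ 0 with rfl | hμ
  · simp
  have hT : 0 < μ.real Set.univ := by
    simpa [measureReal_def, ENNReal.toReal_pos_iff, pos_iff_ne_zero] using hμ
  set T := μ.real Set.univ with hTdef
  set m := ∫ a, f a ∂μ with hm
  let c : n → ℝ := T⁻¹ • m
  let ℓ : (n → ℝ) →ₗ[ℝ] ℝ :=
    { toFun := fun v => c ⬝ᵥ (Q *ᵥ v) + v ⬝ᵥ (Q *ᵥ c)
      map_add' := fun u v => by
        simp only [mulVec_add, dotProduct_add, add_dotProduct]; ring
      map_smul' := fun r v => by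
        simp only [mulVec_smul, dotProduct_smul, smul_dotProduct, smul_eq_mul, RingHom.id_apply]
        ring }
  let L : (n → ℝ) →L[ℝ] ℝ := ℓ.toContinuousLinearMap
  have hL : ∀ v, L v = c ⬝ᵥ (Q *ᵥ v) + v ⬝ᵥ (Q *ᵥ c) := fun _ => rfl
  have tangent : ∀ v, L v - c ⬝ᵥ (Q *ᵥ c) ≤ v ⬝ᵥ (Q *ᵥ v) := fun v => by
    have h := hQ.dotProduct_mulVec_nonneg (v - c)
    simp only [star_trivial, mulVec_sub, dotProduct_sub, sub_dotProduct] at h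
    rw [hL]
    linarith
  have key : ∫ a, (L (f a) - c ⬝ᵥ (Q *ᵥ c)) ∂μ ≤ ∫ a, f a ⬝ᵥ (Q *ᵥ f a) ∂μ :=
    integral_mono ((L.integrable_comp hf).sub (integrable_const _)) hq fun a => tangent (f a)
  rw [integral_sub (L.integrable_comp hf) (integrable_const _), L.integral_comp_comm hf, ← hm,
    integral_const, hL, ← hTdef] at key
  simp only [c, mulVec_smul, dotProduct_smul, smul_dotProduct, smul_eq_mul] at key
  calc m ⬝ᵥ (Q *ᵥ m)
      = T * (T⁻¹ * (m ⬝ᵥ (Q *ᵥ m)) + T⁻¹ * (m ⬝ᵥ (Q *ᵥ m)) -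
          T * (T⁻¹ * (T⁻¹ * (m ⬝ᵥ (Q *ᵥ m))))) := by field_simp; ring
    _ ≤ _ := mul_le_mul_of_nonneg_left key hT.le

/-- Discrete Jensen inequality for a positive semidefinite quadratic form. -/
theorem Matrix.PosSemidef.quadratic_sum_le {n : Type*} [Fintype n] {Q : Matrix n n ℝ}
    (hQ : Q.PosSemidef) {N : ℕ} (x : Fin N → n → ℝ) :
    (∑ i, x i) ⬝ᵥ (Q *ᵥ ∑ i, x i) ≤ (N : ℝ) * ∑ i, x i ⬝ᵥ (Q *ᵥ x i) := by
  simpa [integral_fintype, measureReal_def] using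
    hQ.quadratic_integral_le Measure.count (f := x) .of_finite .of_finite

/-- Corollary 1 (joint discrete + continuous Jensen inequality):
`(∑ xᵢ)ᵀ Q (∑ xᵢ) ≤ N ∑ τᵢ ∫_{-τᵢ}^0 ωᵢᵀQωᵢ`, where `xᵢ = ∫_{-τᵢ}^0 ωᵢ`. -/
theorem joint_jensen {n N : ℕ} (hN : 0 < N)
    (Q : Matrix (Fin n) (Fin n) ℝ) (hQ : Q.PosDef)
    (τ : Fin N → ℝ) (hτ : ∀ i, 0 < τ i)
    (ω : Fin N → ℝ → (Fin n → ℝ))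
    (hω : ∀ i, IntegrableOn (ω i) (Set.Icc (-(τ i)) 0))
    (hq : ∀ i, IntegrableOn (fun s => ω i s ⬝ᵥ (Q *ᵥ ω i s)) (Set.Icc (-(τ i)) 0))
    (x : Fin N → (Fin n → ℝ))
    (hx : ∀ i, x i = ∫ s in Set.Icc (-(τ i)) 0, ω i s) :
    (∑ i, x i) ⬝ᵥ (Q *ᵥ ∑ i, x i)
      ≤ (N : ℝ) * ∑ i, τ i * ∫ s in Set.Icc (-(τ i)) 0, ω i s ⬝ᵥ (Q *ᵥ ω i s) := by
  refine (hQ.posSemidef.quadratic_sum_le x).trans ?_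
  gcongr with i
  have hvol : (volume.restrict (Set.Icc (-(τ i)) 0)).real Set.univ = τ i := by
    simp [measureReal_def, (hτ i).le]
  simpa only [hx i, hvol] using hQ.posSemidef.quadratic_integral_le _ (hω i) (hq i)
end

section
/- Let N be a positive integer, Q₁, …, Q_N n×n real positive definite matrices, and ξ₁, …, ξ_N vectors in ℝⁿ. Then (∑_{i=1}^N ξᵢ)ᵀ (∑_{i=1}^N Qᵢ)⁻¹ (∑_{i=1}^N ξᵢ) ≤ ∑_{i=1}^N ξᵢᵀ Qᵢ⁻¹ ξᵢ (the multiple discrete Jensen inequality). -/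
open Matrix

/-- The Fenchel–Young inequality for the quadratic form of a positive definite matrix. -/
lemma Matrix.PosDef.two_mul_dotProduct_sub_le {ι : Type*} [Fintype ι] [DecidableEq ι]
    {A : Matrix ι ι ℝ} (hA : A.PosDef) (x y : ι → ℝ) :
    2 * (y ⬝ᵥ x) - y ⬝ᵥ (A *ᵥ y) ≤ x ⬝ᵥ (A⁻¹ *ᵥ x) := by
  have hdet : IsUnit A.det := (isUnit_iff_isUnit_det A).mp hA.isUnit
  have hinv : A *ᵥ (A⁻¹ *ᵥ x) = x := by
    rw [mulVec_mulVec, mul_nonsing_inv A hdet, one_mulVec]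
  have hT : Aᵀ = A := by simpa using hA.isHermitian.eq
  have hcross : (A⁻¹ *ᵥ x) ⬝ᵥ (A *ᵥ y) = y ⬝ᵥ x := by
    rw [dotProduct_mulVec, ← mulVec_transpose, hT, hinv, dotProduct_comm]
  have h := hA.posSemidef.dotProduct_mulVec_nonneg (A⁻¹ *ᵥ x - y)
  rw [star_trivial, mulVec_sub, hinv, sub_dotProduct, dotProduct_sub, dotProduct_sub, hcross,
    dotProduct_comm (A⁻¹ *ᵥ x) x] at h
  linarith

/-- The multiple discrete Jensen inequality:
`(∑ ξᵢ)ᵀ (∑ Qᵢ)⁻¹ (∑ ξᵢ) ≤ ∑ ξᵢᵀ Qᵢ⁻¹ ξᵢ`. -/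
theorem multiple_discrete_jensen {n N : ℕ} (hN : 0 < N)
    (Q : Fin N → Matrix (Fin n) (Fin n) ℝ) (hQ : ∀ i, (Q i).PosDef)
    (ξ : Fin N → (Fin n → ℝ)) :
    (∑ i, ξ i) ⬝ᵥ ((∑ i, Q i)⁻¹ *ᵥ ∑ i, ξ i)
      ≤ ∑ i, ξ i ⬝ᵥ ((Q i)⁻¹ *ᵥ ξ i) := by
  have hS : (∑ i, Q i).PosDef := posDef_sum ⟨⟨0, hN⟩, Finset.mem_univ _⟩ fun i _ => hQ i
  have hdet : IsUnit (∑ i, Q i).det := (isUnit_iff_isUnit_det _).mp hS.isUnit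
  set y := (∑ i, Q i)⁻¹ *ᵥ ∑ i, ξ i with hy
  have hSy : (∑ i, Q i) *ᵥ y = ∑ i, ξ i := by
    rw [hy, mulVec_mulVec, mul_nonsing_inv _ hdet, one_mulVec]
  have h := Finset.sum_le_sum fun i (_ : i ∈ Finset.univ) =>
    (hQ i).two_mul_dotProduct_sub_le (ξ i) y
  rw [Finset.sum_sub_distrib, ← Finset.mul_sum, ← dotProduct_sum, ← dotProduct_sum,
    ← sum_mulVec, hSy] at h
  rw [dotProduct_comm]
  linarith
end

section
/- Let N be a positive integer, A₁, …, A_N real n×n matrices, and τ₁, …, τ_N positive real numbers. The following are equivalent: (i) there exist n×n real positive definite matrices S₁, …, S_N, Q₁, …, Q_N such that τᵢ²AᵢᵀQᵢ⁻¹Aᵢ - Sᵢ is negative definite for every i ∈ {1, …, N} and (∑_{i=1}^N Qᵢ)⁻¹ - ∑_{i=1}^N Sᵢ is positive definite; (ii) there exist n×n real positive definite matrices S₁, …, S_N, Q₁, …, Q_N and a real n×n matrix R such that ∑_{i=1}^N Qᵢ + ∑_{i=1}^N Sᵢ - (Rᵀ + R) is negative definite and, for every i ∈ {1, …, N}, the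 2n×2n symmetric block matrix [[-Sᵢ, τᵢAᵢᵀR], [τᵢRᵀAᵢ, -Qᵢ]] is negative definite. -/
open Matrix

/-- Schur complement criterion for positive definiteness of a real block matrix. -/
theorem posDef_fromBlocks_iff_schur {m n : Type*} [Fintype m] [Fintype n] [DecidableEq n]
    (A : Matrix m m ℝ) (B : Matrix m n ℝ) {D : Matrix n n ℝ} (hD : D.PosDef) :
    (fromBlocks A B Bᴴ D).PosDef ↔ (A - B * D⁻¹ * Bᴴ).PosDef := by
  let := hD.isUnit.invertible
  rw [posDef_iff_dotProduct_mulVec, posDef_iff_dotProduct_mulVec, IsHermitian.fromBlocks₂₂ _ _ hD.1]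
  refine and_congr_right fun _ => ⟨fun h x hx => ?_, fun h z hz => ?_⟩
  · have hxy : (x ⊕ᵥ -((D⁻¹ * Bᴴ) *ᵥ x)) ≠ 0 := fun h0 =>
      hx (funext fun i => congrFun h0 (Sum.inl i))
    have := h hxy
    rwa [dotProduct_mulVec, schur_complement_eq₂₂ A B _ _ hD.1, add_neg_cancel, dotProduct_zero,
      zero_add, ← dotProduct_mulVec] at this
  · obtain ⟨x, y, rfl⟩ : ∃ x y, z = x ⊕ᵥ y := ⟨_, _, (Sum.elim_comp_inl_inr z).symm⟩
    rw [dotProduct_mulVec, schur_complement_eq₂₂ A B _ _ hD.1, ← dotProduct_mulVec,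
      ← dotProduct_mulVec]
    by_cases hx : x = 0
    · have hy : y ≠ 0 := by
        rintro rfl
        exact hz (by simp [hx])
      simpa [hx] using hD.dotProduct_mulVec_pos hy
    · exact add_pos_of_nonneg_of_pos (hD.posSemidef.dotProduct_mulVec_nonneg _) (h hx)

/-- Negative definiteness of the block matrix of the LMI, as a nonlinear matrix inequality. -/
theorem posDef_neg_fromBlocks_smul_iff {n : Type*} [Fintype n] [DecidableEq n]
    (A R S : Matrix n n ℝ) {Q : Matrix n n ℝ} (hQ : Q.PosDef) (t : ℝ) :
    (-(fromBlocks (-S) (t • (Aᵀ * R)) (t • (Rᵀ * A)) (-Q))).PosDef ↔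
      (-(t ^ 2 • (Aᵀ * (R * Q⁻¹ * Rᵀ) * A) - S)).PosDef := by
  have h := posDef_fromBlocks_iff_schur S (-(t • (Aᵀ * R))) hQ
  have h₁ : (-(t • (Aᵀ * R)))ᴴ = -(t • (Rᵀ * A)) := by simp [conjTranspose_eq_transpose_of_trivial]
  rw [h₁] at h
  rw [fromBlocks_neg, neg_neg, neg_neg, h, neg_sub]
  simp [Matrix.mul_assoc, smul_smul, pow_two]

/-- A real matrix with positive definite symmetric part is invertible. -/
theorem isUnit_of_posDef_transpose_add {n : Type*} [Fintype n] [DecidableEq n]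
    {R : Matrix n n ℝ} (h : (Rᵀ + R).PosDef) : IsUnit R := by
  rw [← mulVec_injective_iff_isUnit, ← coe_mulVecLin, ← LinearMap.ker_eq_bot,
    LinearMap.ker_eq_bot']
  intro x hx
  by_contra hx0
  have hx : R *ᵥ x = 0 := hx
  have hpos := h.dotProduct_mulVec_pos hx0
  simp [add_mulVec, hx, dotProduct_mulVec, vecMul_transpose] at hpos

/-- Completing the square: `R + Rᵀ - P ≤ R P⁻¹ Rᵀ` for positive definite `P`. -/
theorem posSemidef_mul_inv_mul_transpose_sub {n : Type*} [Fintype n] [DecidableEq n]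
    (R : Matrix n n ℝ) {P : Matrix n n ℝ} (hP : P.PosDef) :
    (R * P⁻¹ * Rᵀ - (Rᵀ + R - P)).PosSemidef := by
  have hdet := (isUnit_iff_isUnit_det P).1 hP.isUnit
  have hPt : Pᵀ = P := hP.isHermitian
  have h := hP.inv.posSemidef.mul_mul_conjTranspose_same (R - P)
  rw [conjTranspose_eq_transpose_of_trivial, transpose_sub, hPt] at h
  suffices heq : R * P⁻¹ * Rᵀ - (Rᵀ + R - P) = (R - P) * P⁻¹ * (Rᵀ - P) from heq ▸ h
  simp only [Matrix.sub_mul, Matrix.mul_sub, Matrix.mul_assoc, nonsing_inv_mul _ hdet,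
    mul_nonsing_inv_cancel_left _ _ hdet, Matrix.mul_one]
  abel

/-- Theorem 1, Item 2: the nonlinear matrix inequalities
`τᵢ²AᵢᵀQᵢ⁻¹Aᵢ - Sᵢ < 0`, `∑Sᵢ < (∑Qᵢ)⁻¹` are solvable iff the LMIs
`∑Qᵢ + ∑Sᵢ - (Rᵀ + R) < 0` and `[[-Sᵢ, τᵢAᵢᵀR], [τᵢRᵀAᵢ, -Qᵢ]] < 0` are solvable. -/
theorem th1_item2 {n N : ℕ} (hN : 0 < N)
    (A : Fin N → Matrix (Fin n) (Fin n) ℝ)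
    (τ : Fin N → ℝ) (hτ : ∀ i, 0 < τ i) :
    (∃ S Q : Fin N → Matrix (Fin n) (Fin n) ℝ,
        (∀ i, (S i).PosDef) ∧ (∀ i, (Q i).PosDef) ∧
        (∀ i, (-((τ i) ^ 2 • ((A i)ᵀ * (Q i)⁻¹ * A i) - S i)).PosDef) ∧
        ((∑ i, Q i)⁻¹ - ∑ i, S i).PosDef) ↔
    (∃ S Q : Fin N → Matrix (Fin n) (Fin n) ℝ, ∃ R : Matrix (Fin n) (Fin n) ℝ,
        (∀ i, (S i).PosDef) ∧ (∀ i, (Q i).PosDef) ∧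
        (-(∑ i, Q i + ∑ i, S i - (Rᵀ + R))).PosDef ∧
        (∀ i, (-(Matrix.fromBlocks (-(S i)) (τ i • ((A i)ᵀ * R))
            (τ i • (Rᵀ * A i)) (-(Q i)))).PosDef)) := by
  have : Nonempty (Fin N) := ⟨⟨0, hN⟩⟩
  constructor
  · rintro ⟨S, Q, hS, hQ, hA, hsum⟩
    have hP : (∑ i, Q i).PosDef := posDef_sum Finset.univ_nonempty fun i _ => hQ i
    set P := ∑ i, Q i with hPdef
    have hdet := (isUnit_iff_isUnit_det P).1 hP.isUnit
    have hRt : P⁻¹ᵀ = P⁻¹ := hP.inv.isHermitian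
    have hRu : IsUnit P⁻¹ := hP.inv.isUnit
    have hQ' : ∀ i, (P⁻¹ * Q i * P⁻¹).PosDef := fun i => by
      have h := (hRu.posDef_star_right_conjugate_iff (x := Q i)).2 (hQ i)
      rwa [star_eq_conjTranspose, hP.inv.isHermitian.eq] at h
    refine ⟨S, fun i => P⁻¹ * Q i * P⁻¹, P⁻¹, hS, hQ', ?_, fun i => ?_⟩
    · rw [← Finset.sum_mul, ← Finset.mul_sum, ← hPdef, nonsing_inv_mul _ hdet, Matrix.one_mul, hRt]
      convert hsum using 1
      abel
    · rw [posDef_neg_fromBlocks_smul_iff _ _ _ (hQ' i), hRt]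
      convert hA i using 6
      rw [Matrix.mul_inv_rev, Matrix.mul_inv_rev, nonsing_inv_nonsing_inv _ hdet,
        nonsing_inv_mul_cancel_left _ _ hdet, Matrix.mul_assoc, mul_nonsing_inv _ hdet,
        Matrix.mul_one]
  · rintro ⟨S, Q, R, hS, hQ, hsum, hA⟩
    have hP : (∑ i, Q i).PosDef := posDef_sum Finset.univ_nonempty fun i _ => hQ i
    have hSs : (∑ i, S i).PosDef := posDef_sum Finset.univ_nonempty fun i _ => hS i
    have hRu : IsUnit R := isUnit_of_posDef_transpose_add <| by
      convert hsum.add (hP.add hSs) using 1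
      abel
    have hdet := (isUnit_iff_isUnit_det R).1 hRu
    have hdett : IsUnit Rᵀ.det := by rwa [det_transpose]
    have hinv : ∀ M : Matrix (Fin n) (Fin n) ℝ, (Rᵀ⁻¹ * M * R⁻¹)⁻¹ = R * M⁻¹ * Rᵀ := fun M => by
      rw [Matrix.mul_inv_rev, Matrix.mul_inv_rev, nonsing_inv_nonsing_inv _ hdet,
        nonsing_inv_nonsing_inv _ hdett, Matrix.mul_assoc]
    refine ⟨S, fun i => Rᵀ⁻¹ * Q i * R⁻¹, hS, fun i => ?_, fun i => ?_, ?_⟩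
    · have hRi : IsUnit R⁻¹ := (isUnit_nonsing_inv_iff).2 hRu
      have h := (hRi.posDef_star_left_conjugate_iff (x := Q i)).2 (hQ i)
      rwa [star_eq_conjTranspose, conjTranspose_eq_transpose_of_trivial,
        transpose_nonsing_inv] at h
    · rw [hinv]
      exact (posDef_neg_fromBlocks_smul_iff _ _ _ (hQ i) _).1 (hA i)
    · rw [← Finset.sum_mul, ← Finset.mul_sum, hinv]
      convert hsum.add_posSemidef (posSemidef_mul_inv_mul_transpose_sub R hP) using 1
      abel
end

section
/- Let N be a positive integer, A₁, …, A_N real n×n matrices, and τ₁, …, τ_N positive real numbers. Let G be the Nn×n real matrix whose i-th n×n block row is τᵢAᵢ. The following are equivalent: (i) there exist n×n real positive definite matrices Q₁, …, Q_N such that (∑_{i=1}^N Qᵢ)⁻¹ - ∑_{i=1}^N τᵢ²AᵢᵀQᵢ⁻¹Aᵢ is positive definite; (ii) there exist n×n real positive definite matrices Q₁, …, Q_N such that the Nn×Nn matrix G(∑_{i=1}^N Qᵢ)Gᵀ - blockdiag(Q₁, …, Q_N) is negative definite. -/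
open Matrix

/-- The `Nn × n` matrix whose `i`-th `n × n` block row is `τᵢ Aᵢ`
(the block index is the second component of the row index). -/
def blockRowMat {n N : ℕ} (A : Fin N → Matrix (Fin n) (Fin n) ℝ)
    (τ : Fin N → ℝ) : Matrix (Fin n × Fin N) (Fin n) ℝ :=
  Matrix.of fun p l => τ p.2 * A p.2 p.1 l

namespace Matrix

variable {m n o 𝕜 : Type*} [Fintype m] [Fintype n] [RCLike 𝕜]

open scoped ComplexOrder

theorem PosDef.blockDiagonal [Fintype o] [DecidableEq o] {Q : o → Matrix n n 𝕜}
    (hQ : ∀ i, (Q i).PosDef) : (blockDiagonal Q).PosDef := by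
  refine .of_dotProduct_mulVec_pos ?_ fun x hx => ?_
  · rw [IsHermitian, blockDiagonal_conjTranspose]
    exact congrArg _ (funext fun i => (hQ i).isHermitian.eq)
  · have key : star x ⬝ᵥ (Matrix.blockDiagonal Q *ᵥ x) =
        ∑ k, star (fun i => x (i, k)) ⬝ᵥ (Q k *ᵥ fun i => x (i, k)) := by
      simp [dotProduct, mulVec, Fintype.sum_prod_type_right, blockDiagonal_apply]
    obtain ⟨⟨i, k⟩, hik⟩ := Function.ne_iff.mp hx
    rw [key]
    exact Finset.sum_pos' (fun k _ => (hQ k).posSemidef.dotProduct_mulVec_nonneg _)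
      ⟨k, Finset.mem_univ k, (hQ k).dotProduct_mulVec_pos fun h => hik (congrFun h i)⟩

variable [DecidableEq m] [DecidableEq n]

theorem PosDef.inv_sub_conjTranspose_mul_inv_mul {P : Matrix n n 𝕜} {D : Matrix m m 𝕜}
    {G : Matrix m n 𝕜} (hP : P.PosDef) (hD : D.PosDef) (h : (D - G * P * Gᴴ).PosDef) :
    (P⁻¹ - Gᴴ * D⁻¹ * G).PosDef := by
  set E := D - G * P * Gᴴ with hE
  have hW := hP.add_posSemidef (h.inv.posSemidef.conjTranspose_mul_mul_same (G * P))
  have hPP : P⁻¹ * P = 1 := nonsing_inv_mul P ((isUnit_iff_isUnit_det P).mp hP.isUnit)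
  have hDD : D⁻¹ * D = 1 := nonsing_inv_mul D ((isUnit_iff_isUnit_det D).mp hD.isUnit)
  have hEE : E * E⁻¹ = 1 := mul_nonsing_inv E ((isUnit_iff_isUnit_det E).mp h.isUnit)
  have hGPG : G * P * Gᴴ = D - E := by rw [hE, sub_sub_cancel]
  have hDE : D⁻¹ * (D - E) * E⁻¹ = E⁻¹ - D⁻¹ := by
    rw [Matrix.mul_sub, Matrix.sub_mul, hDD, Matrix.one_mul, Matrix.mul_assoc, hEE, Matrix.mul_one]
  have hmul : (P⁻¹ - Gᴴ * D⁻¹ * G) * (P + (G * P)ᴴ * E⁻¹ * (G * P)) = 1 := by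
    rw [conjTranspose_mul, hP.isHermitian.eq]
    calc (P⁻¹ - Gᴴ * D⁻¹ * G) * (P + P * Gᴴ * E⁻¹ * (G * P))
        = P⁻¹ * P + P⁻¹ * P * Gᴴ * E⁻¹ * (G * P) - Gᴴ * D⁻¹ * (G * P)
            - Gᴴ * (D⁻¹ * (G * P * Gᴴ) * E⁻¹) * (G * P) := by
          simp only [Matrix.sub_mul, Matrix.mul_add, Matrix.mul_assoc]
          abel
      _ = 1 := by
          rw [hGPG, hDE, hPP, Matrix.one_mul, Matrix.mul_sub, Matrix.sub_mul]
          abel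
  exact inv_eq_left_inv hmul ▸ hW.inv

theorem posDef_inv_sub_conjTranspose_mul_inv_mul_iff {P : Matrix n n 𝕜} {D : Matrix m m 𝕜}
    (G : Matrix m n 𝕜) (hP : P.PosDef) (hD : D.PosDef) :
    (P⁻¹ - Gᴴ * D⁻¹ * G).PosDef ↔ (D - G * P * Gᴴ).PosDef := by
  refine ⟨fun h => ?_, hP.inv_sub_conjTranspose_mul_inv_mul hD⟩
  have hPi := nonsing_inv_nonsing_inv P ((isUnit_iff_isUnit_det P).mp hP.isUnit)
  have hDi := nonsing_inv_nonsing_inv D ((isUnit_iff_isUnit_det D).mp hD.isUnit)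
  simpa [hPi, hDi] using
    hD.inv.inv_sub_conjTranspose_mul_inv_mul (G := Gᴴ) hP.inv (by simpa using h)

theorem blockDiagonal_inv_of_isUnit [Fintype o] [DecidableEq o] {Q : o → Matrix n n 𝕜}
    (hQ : ∀ i, IsUnit (Q i)) : (blockDiagonal Q)⁻¹ = blockDiagonal fun i => (Q i)⁻¹ := by
  refine inv_eq_left_inv ?_
  rw [← blockDiagonal_mul, ← blockDiagonal_one]
  exact congrArg _ (funext fun i => nonsing_inv_mul _ ((isUnit_iff_isUnit_det _).mp (hQ i)))

end Matrix

theorem transpose_blockRowMat_mul_blockDiagonal_mul {n N : ℕ}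
    (A : Fin N → Matrix (Fin n) (Fin n) ℝ) (τ : Fin N → ℝ) (R : Fin N → Matrix (Fin n) (Fin n) ℝ) :
    (blockRowMat A τ)ᵀ * blockDiagonal R * blockRowMat A τ =
      ∑ i, (τ i) ^ 2 • ((A i)ᵀ * R i * A i) := by
  ext a b
  simp only [mul_apply, Matrix.sum_apply, Matrix.smul_apply, blockRowMat, transpose_apply, of_apply,
    Fintype.sum_prod_type_right, blockDiagonal_apply, mul_ite, mul_zero, Finset.sum_mul,
    smul_eq_mul, Finset.mul_sum]
  refine Finset.sum_congr rfl fun k _ => Finset.sum_congr rfl fun i _ => ?_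
  rw [Finset.sum_eq_single k]
  · exact Finset.sum_congr rfl fun j _ => by simp; ring
  · intro l _ hl
    simp [hl]
  · simp

/-- Theorem 2, Item 2: the nonlinear matrix inequality
`∑ τᵢ²AᵢᵀQᵢ⁻¹Aᵢ - (∑Qᵢ)⁻¹ < 0` is solvable iff the LMI
`G (∑ Qᵢ) Gᵀ - blockdiag(Q₁,…,Q_N) < 0` is solvable, where the `i`-th
block row of `G` is `τᵢAᵢ`. -/
theorem th2_item2 {n N : ℕ} (hN : 0 < N)
    (A : Fin N → Matrix (Fin n) (Fin n) ℝ)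
    (τ : Fin N → ℝ) (hτ : ∀ i, 0 < τ i) :
    (∃ Q : Fin N → Matrix (Fin n) (Fin n) ℝ,
        (∀ i, (Q i).PosDef) ∧
        ((∑ i, Q i)⁻¹ - ∑ i, (τ i) ^ 2 • ((A i)ᵀ * (Q i)⁻¹ * A i)).PosDef) ↔
    (∃ Q : Fin N → Matrix (Fin n) (Fin n) ℝ,
        (∀ i, (Q i).PosDef) ∧
        (-(blockRowMat A τ * (∑ i, Q i) * (blockRowMat A τ)ᵀ
            - Matrix.blockDiagonal Q)).PosDef) := by
  refine exists_congr fun Q => and_congr_right fun hQ => ?_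
  have : Nonempty (Fin N) := ⟨⟨0, hN⟩⟩
  have hS : (∑ i, Q i).PosDef := posDef_sum Finset.univ_nonempty fun i _ => hQ i
  rw [neg_sub, ← transpose_blockRowMat_mul_blockDiagonal_mul A τ fun i => (Q i)⁻¹,
    ← blockDiagonal_inv_of_isUnit fun i => (hQ i).isUnit, ← conjTranspose_eq_transpose_of_trivial]
  exact posDef_inv_sub_conjTranspose_mul_inv_mul_iff _ hS (.blockDiagonal hQ)
end

section
/- Let N be a positive integer, A₁, …, A_N real n×n matrices, and τ₁, …, τ_N positive real numbers. The following are equivalent: (i) there exist n×n real positive definite matrices P, Q₁, …, Q_N such that NτᵢAᵢᵀ(P + ∑_{j=1}^N τⱼQⱼ)Aᵢ - Qᵢ is negative definite for every i ∈ {1, …, N}; (ii) there exist n×n real positive definite matrices Q₁, …, Q_N such that Nτᵢ²Aᵢᵀ(∑_{j=1}^N Qⱼ)Aᵢ - Qᵢ is negative definite for every i ∈ {1, …, N}. -/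
open Matrix

/-- A positive definite real quadratic form dominates a multiple of any other quadratic form. -/
theorem Matrix.PosDef.exists_dotProduct_mulVec_le {ι : Type*} [Fintype ι]
    {M : Matrix ι ι ℝ} (hM : M.PosDef) (K : Matrix ι ι ℝ) :
    ∃ C : ℝ, 0 < C ∧ ∀ x : ι → ℝ, x ⬝ᵥ (K *ᵥ x) ≤ C * (x ⬝ᵥ (M *ᵥ x)) := by
  have hpos : ∀ x : ι → ℝ, x ≠ 0 → 0 < x ⬝ᵥ (M *ᵥ x) := fun x hx => by
    simpa using hM.dotProduct_mulVec_pos hx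
  have hcont : ContinuousOn (fun x : ι → ℝ => (x ⬝ᵥ (K *ᵥ x)) / (x ⬝ᵥ (M *ᵥ x)))
      (Metric.sphere 0 1) := by
    refine ContinuousOn.div (by fun_prop) (by fun_prop) fun x hx => ?_
    exact (hpos x (ne_zero_of_mem_unit_sphere ⟨x, hx⟩)).ne'
  obtain ⟨C, hC⟩ := (isCompact_sphere (0 : ι → ℝ) 1).bddAbove_image hcont
  refine ⟨max C 1, by positivity, fun x => ?_⟩
  rcases eq_or_ne x 0 with rfl | hx
  · simp
  have hmem : ‖x‖⁻¹ • x ∈ Metric.sphere (0 : ι → ℝ) 1 := by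
    simp [norm_smul, hx]
  have h := hC (Set.mem_image_of_mem _ hmem)
  have hn : ‖x‖⁻¹ ≠ 0 := by simpa using hx
  simp only [mulVec_smul, dotProduct_smul, smul_dotProduct, smul_eq_mul] at h
  rw [mul_div_mul_left _ _ hn, mul_div_mul_left _ _ hn, div_le_iff₀ (hpos x hx)] at h
  exact h.trans (mul_le_mul_of_nonneg_right (le_max_left _ _) (hpos x hx).le)

/-- Positive definiteness is stable under small Hermitian perturbations. -/
theorem Matrix.PosDef.eventually_sub_smul {ι : Type*} [Fintype ι]
    {M K : Matrix ι ι ℝ} (hM : M.PosDef) (hK : K.IsHermitian) :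
    ∀ᶠ ε : ℝ in nhdsWithin 0 (Set.Ioi 0), (M - ε • K).PosDef := by
  obtain ⟨C, hC, h⟩ := hM.exists_dotProduct_mulVec_le K
  filter_upwards [Ioo_mem_nhdsGT (inv_pos.mpr hC)] with ε hε
  refine .of_dotProduct_mulVec_pos (hM.isHermitian.sub ?_) fun x hx => ?_
  · exact hK.smul (IsSelfAdjoint.all ε)
  have hp : 0 < x ⬝ᵥ (M *ᵥ x) := by simpa using hM.dotProduct_mulVec_pos hx
  have h1 : ε * C < 1 := by
    simpa [hC.ne'] using mul_lt_mul_of_pos_right hε.2 hC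
  have h2 := mul_le_mul_of_nonneg_left (h x) hε.1.le
  simp only [star_trivial, sub_mulVec, dotProduct_sub, smul_mulVec, dotProduct_smul, smul_eq_mul]
  nlinarith

/-- Theorem 3, A ⇔ B: the coupled LMIs `NτᵢAᵢᵀ(P + ∑τⱼQⱼ)Aᵢ - Qᵢ < 0` are
solvable iff the coupled LMIs `Nτᵢ²Aᵢᵀ(∑Qⱼ)Aᵢ - Qᵢ < 0` are solvable. -/
theorem th3_A_iff_B {n N : ℕ} (hN : 0 < N)
    (A : Fin N → Matrix (Fin n) (Fin n) ℝ)
    (τ : Fin N → ℝ) (hτ : ∀ i, 0 < τ i) :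
    (∃ P : Matrix (Fin n) (Fin n) ℝ, ∃ Q : Fin N → Matrix (Fin n) (Fin n) ℝ,
        P.PosDef ∧ (∀ i, (Q i).PosDef) ∧
        (∀ i, (-(((N : ℝ) * τ i) • ((A i)ᵀ * (P + ∑ j, τ j • Q j) * A i) - Q i)).PosDef)) ↔
    (∃ Q : Fin N → Matrix (Fin n) (Fin n) ℝ,
        (∀ i, (Q i).PosDef) ∧
        (∀ i, (-(((N : ℝ) * (τ i) ^ 2) • ((A i)ᵀ * (∑ j, Q j) * A i) - Q i)).PosDef)) := by
  constructor
  · rintro ⟨P, Q, hP, hQ, h⟩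
    refine ⟨fun i => τ i • Q i, fun i => (hQ i).smul (hτ i), fun i => ?_⟩
    have hPA : ((A i)ᵀ * P * A i).PosSemidef := by
      simpa using hP.posSemidef.conjTranspose_mul_mul_same (A i)
    have hc : 0 ≤ (N : ℝ) * τ i ^ 2 := by positivity
    convert ((h i).smul (hτ i)).add_posSemidef (hPA.smul hc) using 1
    simp only [Matrix.mul_add, Matrix.add_mul]
    module
  · rintro ⟨Q, hQ, h⟩
    have hA (i : Fin N) : ((N * τ i) • ((A i)ᵀ * A i)).IsHermitian := by
      have := isHermitian_conjTranspose_mul_self (A i)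
      rw [conjTranspose_eq_transpose_of_trivial] at this
      exact this.smul (IsSelfAdjoint.all _)
    have hev : ∀ᶠ ε : ℝ in nhdsWithin 0 (Set.Ioi 0), ∀ i,
        ((τ i)⁻¹ • (-(((N : ℝ) * (τ i) ^ 2) • ((A i)ᵀ * (∑ j, Q j) * A i) - Q i))
          - ε • ((N * τ i) • ((A i)ᵀ * A i))).PosDef :=
      Filter.eventually_all.mpr fun i =>
        ((h i).smul (inv_pos.mpr (hτ i))).eventually_sub_smul (hA i)
    obtain ⟨ε, hε, hpos⟩ := (hev.and self_mem_nhdsWithin).exists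
    refine ⟨ε • 1, fun i => (τ i)⁻¹ • Q i, PosDef.one.smul hpos,
      fun i => (hQ i).smul (inv_pos.mpr (hτ i)), fun i => ?_⟩
    have hsum : ∑ j, τ j • (τ j)⁻¹ • Q j = ∑ j, Q j :=
      Finset.sum_congr rfl fun j _ => smul_inv_smul₀ (hτ j).ne' _
    convert hε i using 1
    have hi := (hτ i).ne'
    simp only [hsum, Matrix.mul_add, Matrix.add_mul, Matrix.mul_smul, Matrix.smul_mul,
      Matrix.mul_one]
    match_scalars <;> field_simp
end

section
/- Let N be a positive integer, A₁, …, A_N real n×n matrices, and τ₁, …, τ_N positive real numbers. If there exist n×n real positive definite matrices Q₁, …, Q_N such that Nτᵢ²Aᵢᵀ(∑_{j=1}^N Qⱼ)Aᵢ - Qᵢ is negative definite for every i ∈ {1, …, N}, then there exist n×n real positive definite matrices S₁, …, S_N, Q̃₁, …, Q̃_N such that τᵢ²AᵢᵀQ̃ᵢ⁻¹Aᵢ - Sᵢ is negative definite for every i ∈ {1, …, N} and (∑_{i=1}^N Q̃ᵢ)⁻¹ - ∑_{i=1}^N Sᵢ is positive definite. -/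
open Matrix

/-- Proposition 1, Item 1: solvability of the coupled LMIs
`Nτᵢ²Aᵢᵀ(∑Qⱼ)Aᵢ - Qᵢ < 0` implies solvability of the nonlinear matrix
inequalities `τᵢ²AᵢᵀQ̃ᵢ⁻¹Aᵢ - Sᵢ < 0`, `∑Sᵢ < (∑Q̃ᵢ)⁻¹`. -/
theorem prop1_item1 {n N : ℕ} (hN : 0 < N)
    (A : Fin N → Matrix (Fin n) (Fin n) ℝ)
    (τ : Fin N → ℝ) (hτ : ∀ i, 0 < τ i)
    (h : ∃ Q : Fin N → Matrix (Fin n) (Fin n) ℝ,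
        (∀ i, (Q i).PosDef) ∧
        (∀ i, (-(((N : ℝ) * (τ i) ^ 2) • ((A i)ᵀ * (∑ j, Q j) * A i) - Q i)).PosDef)) :
    ∃ S Qt : Fin N → Matrix (Fin n) (Fin n) ℝ,
        (∀ i, (S i).PosDef) ∧ (∀ i, (Qt i).PosDef) ∧
        (∀ i, (-((τ i) ^ 2 • ((A i)ᵀ * (Qt i)⁻¹ * A i) - S i)).PosDef) ∧
        ((∑ i, Qt i)⁻¹ - ∑ i, S i).PosDef := by
  obtain ⟨Q, hQ, hR⟩ := h
  have : Nonempty (Fin N) := ⟨⟨0, hN⟩⟩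
  have hN' : (0 : ℝ) < N := by exact_mod_cast hN
  have hP : (∑ j, Q j).PosDef := Matrix.posDef_sum Finset.univ_nonempty fun i _ => hQ i
  set P := ∑ j, Q j with hPdef
  set R : Fin N → Matrix (Fin n) (Fin n) ℝ :=
    fun i => -(((N : ℝ) * (τ i) ^ 2) • ((A i)ᵀ * P * A i) - Q i) with hRdef
  have hhalf : (0 : ℝ) < 1 / 2 := by norm_num
  have hR' : ∀ i, ((1 / 2 : ℝ) • R i).PosDef := fun i => (hR i).smul hhalf
  have hinv : ((N : ℝ)⁻¹ • P⁻¹)⁻¹ = (N : ℝ) • P := by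
    refine Matrix.inv_eq_left_inv ?_
    rw [smul_mul_smul_comm, mul_inv_cancel₀ hN'.ne', one_smul,
      Matrix.mul_nonsing_inv _ ((Matrix.isUnit_iff_isUnit_det _).mp hP.isUnit)]
  have hsum : (∑ _i : Fin N, (N : ℝ)⁻¹ • P⁻¹)⁻¹ = P := by
    rw [Finset.sum_const, Finset.card_univ, Fintype.card_fin, ← Nat.cast_smul_eq_nsmul ℝ,
      smul_smul, mul_inv_cancel₀ hN'.ne', one_smul,
      Matrix.nonsing_inv_nonsing_inv _ ((Matrix.isUnit_iff_isUnit_det _).mp hP.isUnit)]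
  refine ⟨fun i => Q i - (1 / 2 : ℝ) • R i, fun _ => (N : ℝ)⁻¹ • P⁻¹, fun i => ?_,
    fun _ => hP.inv.smul (inv_pos.mpr hN'), fun i => ?_, ?_⟩
  · have hpsd : (((N : ℝ) * (τ i) ^ 2 / 2) • ((A i)ᵀ * P * A i)).PosSemidef := by
      refine Matrix.PosSemidef.smul ?_ (by positivity)
      simpa [Matrix.conjTranspose_eq_transpose_of_trivial] using
        hP.posSemidef.conjTranspose_mul_mul_same (A i)
    convert ((hQ i).smul hhalf).add_posSemidef hpsd using 1
    simp only [hRdef]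
    module
  · convert hR' i using 1
    simp only [hinv, hRdef, Matrix.mul_smul, Matrix.smul_mul]
    module
  · convert Matrix.posDef_sum Finset.univ_nonempty fun i _ => hR' i using 1
    rw [hsum, Finset.sum_sub_distrib, ← hPdef, sub_sub_cancel]
end

section
/- Let N ≥ 1 and A₁, …, A_N be real n×n matrices, and let G be the Nn×n real matrix whose i-th n×n block row is Aᵢ. The following are equivalent: (i) there exist n×n real positive definite matrices X₁, …, X_N such that the Nn×Nn block matrix whose (i, i)-th block is Xᵢ - AᵢX₁Aᵢᵀ - X_{i+1} for i ∈ {1, …, N-1}, whose (N, N)-th block is X_N - A_N X₁ A_Nᵀ, and whose (i, j)-th block for i ≠ j is -AᵢX₁Aⱼᵀ, is positive definite; (ii) there exist n×n real positive definite matrices Q₁, …, Q_N such that the Nn×Nn matrix blockdiag(Q₁, …, Q_N) - G(∑_{i=1}^N Qᵢ)Gᵀ is positive definite. -/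
open Matrix

/-- The `Nn × n` matrix whose `i`-th `n × n` block row is `Aᵢ`
(the block index is the second component of the row index). -/
def stackMat {n N : ℕ} (A : Fin N → Matrix (Fin n) (Fin n) ℝ) :
    Matrix (Fin n × Fin N) (Fin n) ℝ :=
  Matrix.of fun p l => A p.2 p.1 l

/-- The `Nn × Nn` block matrix of inequality (4.6) in Carvalho (1996): its
`(i,i)`-th block is `Xᵢ - AᵢX₁Aᵢᵀ - X_{i+1}` for `i < N`, its `(N,N)`-th block
is `X_N - A_N X₁ A_Nᵀ`, and its `(i,j)`-th block for `i ≠ j` is `-AᵢX₁Aⱼᵀ`.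
(The block index is the second component of the row/column index.) -/
def carvalhoMat {n N : ℕ} (hN : 0 < N)
    (A X : Fin N → Matrix (Fin n) (Fin n) ℝ) :
    Matrix (Fin n × Fin N) (Fin n × Fin N) ℝ :=
  Matrix.of fun p q =>
    ((if p.2 = q.2 then
        X p.2 - (if h : (p.2 : ℕ) + 1 < N then X ⟨(p.2 : ℕ) + 1, h⟩ else 0)
      else 0)
      - A p.2 * X ⟨0, hN⟩ * (A q.2)ᵀ) p.1 q.1

/-- The block-difference `Xᵢ - X_{i+1}`, with `X_{N+1} = 0`. -/
def blockDiff {n N : ℕ} (X : Fin N → Matrix (Fin n) (Fin n) ℝ) (i : Fin N) :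
    Matrix (Fin n) (Fin n) ℝ :=
  X i - if h : (i : ℕ) + 1 < N then X ⟨(i : ℕ) + 1, h⟩ else 0

lemma stackMat_mul_mul_transpose_apply {n N : ℕ} (A : Fin N → Matrix (Fin n) (Fin n) ℝ)
    (S : Matrix (Fin n) (Fin n) ℝ) (p q : Fin n × Fin N) :
    (stackMat A * S * (stackMat A)ᵀ) p q = (A p.2 * S * (A q.2)ᵀ) p.1 q.1 := by
  simp [Matrix.mul_apply, stackMat]

lemma carvalhoMat_eq {n N : ℕ} (hN : 0 < N) (A X : Fin N → Matrix (Fin n) (Fin n) ℝ) :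
    carvalhoMat hN A X =
      Matrix.blockDiagonal (blockDiff X) - stackMat A * X ⟨0, hN⟩ * (stackMat A)ᵀ := by
  ext p q
  rw [Matrix.sub_apply, stackMat_mul_mul_transpose_apply, Matrix.blockDiagonal_apply']
  simp only [carvalhoMat, Matrix.of_apply, Matrix.sub_apply, blockDiff]
  split_ifs <;> simp

lemma sum_blockDiff {n N : ℕ} (hN : 0 < N) (X : Fin N → Matrix (Fin n) (Fin n) ℝ) :
    ∑ i, blockDiff X i = X ⟨0, hN⟩ := by
  let Y : ℕ → Matrix (Fin n) (Fin n) ℝ := fun k => if h : k < N then X ⟨k, h⟩ else 0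
  have hY : ∀ i : Fin N, blockDiff X i = Y i - Y (i + 1) := fun i => by simp [blockDiff, Y]
  simp_rw [hY]
  rw [Fin.sum_univ_eq_sum_range (fun k => Y k - Y (k + 1)), Finset.sum_range_sub']
  simp [Y, hN]

lemma blockDiff_sum_Ici {n N : ℕ} (Q : Fin N → Matrix (Fin n) (Fin n) ℝ) :
    blockDiff (fun i => ∑ j ∈ Finset.Ici i, Q j) = Q := by
  funext i
  have hIoi : (if h : (i : ℕ) + 1 < N then ∑ j ∈ Finset.Ici (⟨(i : ℕ) + 1, h⟩ : Fin N), Q j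
      else 0) = ∑ j ∈ Finset.Ioi i, Q j := by
    split_ifs with h
    · congr 1
      ext j
      simp only [Finset.mem_Ici, Finset.mem_Ioi, Fin.le_def, Fin.lt_def, Nat.succ_le_iff]
    · symm
      apply Finset.sum_eq_zero
      intro j hj
      have := Fin.lt_def.mp (Finset.mem_Ioi.mp hj)
      omega
  rw [blockDiff, hIoi, ← Finset.Ioi_insert, Finset.sum_insert (by simp), add_sub_cancel_right]

lemma posDef_of_posDef_blockDiagonal_sub {n N : ℕ} {A Q : Fin N → Matrix (Fin n) (Fin n) ℝ}
    {S : Matrix (Fin n) (Fin n) ℝ} (hS : S.PosSemidef)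
    (h : (Matrix.blockDiagonal Q - stackMat A * S * (stackMat A)ᵀ).PosDef) (i : Fin N) :
    (Q i).PosDef := by
  have hsub := h.submatrix (e := fun a : Fin n => (a, i)) (fun a b hab => (Prod.ext_iff.mp hab).1)
  have hpsd : (A i * S * (A i)ᵀ).PosSemidef := by
    simpa using hS.mul_mul_conjTranspose_same (A i)
  convert hsub.add_posSemidef hpsd using 1
  ext a b
  rw [Matrix.add_apply, Matrix.submatrix_apply, Matrix.sub_apply,
    stackMat_mul_mul_transpose_apply, Matrix.blockDiagonal_apply_eq, sub_add_cancel]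

/-- Lemma 5 (equivalence of the two LMI forms of Carvalho's condition):
the LMI (4.6) of Carvalho is solvable iff the LMI
`blockdiag(Q₁,…,Q_N) - G(∑Qᵢ)Gᵀ > 0` is solvable, where the `i`-th block row
of `G` is `Aᵢ`. -/
theorem carvalho_lmi_equiv {n N : ℕ} (hN : 1 ≤ N)
    (A : Fin N → Matrix (Fin n) (Fin n) ℝ) :
    (∃ X : Fin N → Matrix (Fin n) (Fin n) ℝ,
        (∀ i, (X i).PosDef) ∧ (carvalhoMat hN A X).PosDef) ↔
    (∃ Q : Fin N → Matrix (Fin n) (Fin n) ℝ,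
        (∀ i, (Q i).PosDef) ∧
        (Matrix.blockDiagonal Q - stackMat A * (∑ i, Q i) * (stackMat A)ᵀ).PosDef) := by
  constructor
  · rintro ⟨X, hX, h⟩
    rw [carvalhoMat_eq] at h
    refine ⟨blockDiff X, posDef_of_posDef_blockDiagonal_sub (hX _).posSemidef h, ?_⟩
    rwa [sum_blockDiff hN]
  · rintro ⟨Q, hQ, h⟩
    refine ⟨fun i => ∑ j ∈ Finset.Ici i, Q j,
      fun i => Matrix.posDef_sum ⟨i, by simp⟩ fun j _ => hQ j, ?_⟩
    rwa [carvalhoMat_eq, ← sum_blockDiff hN (fun i => ∑ j ∈ Finset.Ici i, Q j),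
      blockDiff_sum_Ici]
end
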